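/- Let 0 < γ < 2 and let R: V → ℝ be a nowhere-vanishing solution of the radii system with parameter γ. Then the function z ↦ 1/R(z) is a solution of the radii system with parameter γ̃ = 2 − γ. -/

import Mathlib

open Real
/-- Membership of `z = N + i M` in the quadrant `V = {N + iM : M ≥ |N|}`. -/
def inV (N M : ℤ) : Prop := |N| ≤ M

/-- Membership of `z = N + i M` in the interior part `V_int = {N + iM : M > |N|}`. -/
def inVint (N M : ℤ) : Prop := |N| < M

/-- Equation (square) at `z = N + i M`  (here `z + 1` shifts `N`, `z + i` shifts `M`). -/
def SquareEq (γ : ℝ) (R : ℤ → ℤ → ℝ) (N M : ℤ) : Prop :=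
  R N M * R (N + 1) M * (-2 * (M : ℝ) - γ) +
    R (N + 1) M * R (N + 1) (M + 1) * (2 * ((N : ℝ) + 1) - γ) +
    R (N + 1) (M + 1) * R N (M + 1) * (2 * ((M : ℝ) + 1) - γ) +
    R N (M + 1) * R N M * (-2 * (N : ℝ) - γ) = 0

/-- Equation (Ri) at `z = N + i M`. -/
def RiEq (R : ℤ → ℤ → ℝ) (N M : ℤ) : Prop :=
  ((N : ℝ) + M) * (R N M ^ 2 - R (N + 1) M * R N (M - 1)) * (R N (M + 1) + R (N + 1) M) +
    ((M : ℝ) - N) * (R N M ^ 2 - R N (M + 1) * R (N + 1) M) * (R (N + 1) M + R N (M - 1)) = 0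

/-- `R : V → ℝ` is a solution of the radii system: (square) holds whenever all four
corners lie in `V`, (recR) holds on both diagonals, and (Ri) holds on `V_int`. -/
def IsRadiiSolution (γ : ℝ) (R : ℤ → ℤ → ℝ) : Prop :=
  (∀ N M : ℤ, inV N M → inV (N + 1) M → inV N (M + 1) → inV (N + 1) (M + 1) →
      SquareEq γ R N M) ∧
  (∀ N : ℕ, R ((N : ℤ) + 1) ((N : ℤ) + 1) =
        ((2 * (N : ℝ) + γ) / (2 * ((N : ℝ) + 1) - γ)) * R (N : ℤ) (N : ℤ) ∧
      R (-((N : ℤ) + 1)) ((N : ℤ) + 1) =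
        ((2 * (N : ℝ) + γ) / (2 * ((N : ℝ) + 1) - γ)) * R (-(N : ℤ)) (N : ℤ)) ∧
  (∀ N M : ℤ, inVint N M → RiEq R N M)

/-- if `R` is a nowhere-vanishing solution of the radii system for `γ`,
then `1/R` is a solution for `2 - γ`. -/
theorem stmt15 (γ : ℝ) (hγ0 : 0 < γ) (hγ2 : γ < 2)
    (R : ℤ → ℤ → ℝ) (hsol : IsRadiiSolution γ R)
    (hne : ∀ N M : ℤ, inV N M → R N M ≠ 0) :
    IsRadiiSolution (2 - γ) (fun N M => (R N M)⁻¹) := by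
  obtain ⟨h1, h2, h3⟩ := hsol
  refine ⟨?_, ?_, ?_⟩
  · intro N M ha hb hc hd
    have h := h1 N M ha hb hc hd
    have a0 := hne _ _ ha
    have b0 := hne _ _ hb
    have c0 := hne _ _ hc
    have d0 := hne _ _ hd
    unfold SquareEq at h ⊢
    dsimp only
    generalize R N M = a at *
    generalize R (N + 1) M = b at *
    generalize R N (M + 1) = c at *
    generalize R (N + 1) (M + 1) = d at *
    field_simp
    linear_combination -h
  · intro N
    have hN : (0 : ℝ) ≤ (N : ℝ) := Nat.cast_nonneg N
    have e : (2 * (N : ℝ) + (2 - γ)) / (2 * ((N : ℝ) + 1) - (2 - γ))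
        = ((2 * (N : ℝ) + γ) / (2 * ((N : ℝ) + 1) - γ))⁻¹ := by
      rw [inv_div]
      congr 1 <;> ring
    obtain ⟨p, q⟩ := h2 N
    constructor
    · dsimp only
      rw [p, mul_inv, e]
    · dsimp only
      rw [q, mul_inv, e]
  · intro N M hz
    have h := h3 N M hz
    unfold inVint at hz
    have hz' := abs_lt.mp hz
    have a0 := hne N M (by unfold inV; omega)
    have b0 := hne (N + 1) M (by unfold inV; rw [abs_le]; omega)
    have c0 := hne N (M + 1) (by unfold inV; omega)
    have d0 := hne N (M - 1) (by unfold inV; omega)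
    unfold RiEq at h ⊢
    dsimp only
    generalize R N M = a at *
    generalize R (N + 1) M = b at *
    generalize R N (M + 1) = c at *
    generalize R N (M - 1) = d at *
    field_simp
    linear_combination -h
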